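/- Let d ≥ 1, L ≥ 2 and Φ ∈ ℝ^{d×d}. Suppose W_1, …, W_L : [0,∞) → ℝ^{d×d} are differentiable and satisfy the continuous-time gradient descent dynamics d/dt W_l(t) = −∇_l R(t) for l = 1,…,L (with arbitrary initialization). Then the invariant matrices are conserved: D_l(t) = D_l(0) for every l = 1,…,L−1 and every t ≥ 0. -/

import Mathlib

open Matrix

namespace ZAS

/-- `seg W l₁ l₂ = W l₂ * W (l₂-1) * ⋯ * W l₁` (the empty product, when `l₂ < l₁`, is `1`). -/
noncomputable def seg {d : ℕ} (W : ℕ → Matrix (Fin d) (Fin d) ℝ) (l₁ : ℕ) :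
    ℕ → Matrix (Fin d) (Fin d) ℝ
  | 0 => 1
  | (k+1) => if k + 1 < l₁ then 1 else W (k+1) * seg W l₁ k

/-- Squared Frobenius norm `‖A‖_F²`. -/
noncomputable def frobSq {m n : ℕ} (A : Matrix (Fin m) (Fin n) ℝ) : ℝ :=
  ∑ i, ∑ j, (A i j)^2

/-- Frobenius norm `‖A‖_F`. -/
noncomputable def frob {m n : ℕ} (A : Matrix (Fin m) (Fin n) ℝ) : ℝ :=
  Real.sqrt (frobSq A)

/-- Frobenius inner product `⟨A, B⟩ = tr(Aᵀ B)`. -/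
noncomputable def finner {m n : ℕ} (A B : Matrix (Fin m) (Fin n) ℝ) : ℝ :=
  ∑ i, ∑ j, A i j * B i j

/-- The loss `R(W_1, …, W_L) = (1/2) ‖W_{L:1} - Φ‖_F²`. -/
noncomputable def loss {d : ℕ} (W : ℕ → Matrix (Fin d) (Fin d) ℝ)
    (Φ : Matrix (Fin d) (Fin d) ℝ) (L : ℕ) : ℝ :=
  frobSq (seg W 1 L - Φ) / 2

/-- The gradient `∇_l R = W_{L:l+1}ᵀ (W_{L:1} - Φ) W_{l-1:1}ᵀ`. -/
noncomputable def grad {d : ℕ} (W : ℕ → Matrix (Fin d) (Fin d) ℝ)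
    (Φ : Matrix (Fin d) (Fin d) ℝ) (L l : ℕ) : Matrix (Fin d) (Fin d) ℝ :=
  (seg W (l+1) L)ᵀ * (seg W 1 L - Φ) * (seg W 1 (l-1))ᵀ

/-- The invariant matrices `D_l = W_{l+1}ᵀ W_{l+1} - W_l W_lᵀ`. -/
noncomputable def Dmat {d : ℕ} (W : ℕ → Matrix (Fin d) (Fin d) ℝ) (l : ℕ) :
    Matrix (Fin d) (Fin d) ℝ :=
  (W (l+1))ᵀ * W (l+1) - W l * (W l)ᵀ

/-- Spectral norm (operator 2-norm) of a square real matrix. -/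
noncomputable def spec {d : ℕ} (A : Matrix (Fin d) (Fin d) ℝ) : ℝ :=
  ‖Matrix.toEuclideanCLM (𝕜 := ℝ) A‖

/-- The loss on data: `R̃ = (1/2) ‖W_{L:1} X - Y‖_F²`. -/
noncomputable def lossT {d n : ℕ} (W : ℕ → Matrix (Fin d) (Fin d) ℝ)
    (X Y : Matrix (Fin d) (Fin n) ℝ) (L : ℕ) : ℝ :=
  frobSq (seg W 1 L * X - Y) / 2

/-- The gradient of the data loss: `∇_l R̃ = W_{L:l+1}ᵀ (W_{L:1} X - Y) Xᵀ W_{l-1:1}ᵀ`. -/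
noncomputable def gradT {d n : ℕ} (W : ℕ → Matrix (Fin d) (Fin d) ℝ)
    (X Y : Matrix (Fin d) (Fin n) ℝ) (L l : ℕ) : Matrix (Fin d) (Fin d) ℝ :=
  (seg W (l+1) L)ᵀ * (seg W 1 L * X - Y) * Xᵀ * (seg W 1 (l-1))ᵀ

end ZAS

open ZAS
theorem seg_of_lt {d : ℕ} (W : ℕ → Matrix (Fin d) (Fin d) ℝ) {m n : ℕ} (h : n < m) :
    seg W m n = 1 := by
  cases n with
  | zero => rfl
  | succ n => rw [seg, if_pos h]

theorem seg_succ {d : ℕ} (W : ℕ → Matrix (Fin d) (Fin d) ℝ) {m n : ℕ} (h : m ≤ n + 1) :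
    seg W m (n + 1) = W (n + 1) * seg W m n := by
  rw [seg, if_neg (by omega)]

theorem seg_eq_seg_succ_mul {d : ℕ} (W : ℕ → Matrix (Fin d) (Fin d) ℝ) {m n : ℕ}
    (hm : 1 ≤ m) (h : m ≤ n) : seg W m n = seg W (m + 1) n * W m := by
  induction n, h using Nat.le_induction with
  | base =>
    obtain ⟨k, rfl⟩ := Nat.exists_eq_add_of_le' hm
    rw [seg_succ W le_rfl, seg_of_lt W (Nat.lt_succ_self k),
      seg_of_lt W (Nat.lt_succ_self (k + 1)), mul_one, one_mul]
  | succ n h ih =>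
    rw [seg_succ W (by omega), seg_succ W (by omega), ih, Matrix.mul_assoc]

theorem transpose_mul_grad_succ {d : ℕ} (W : ℕ → Matrix (Fin d) (Fin d) ℝ)
    (Φ : Matrix (Fin d) (Fin d) ℝ) {L l : ℕ} (hl : 1 ≤ l) (hlL : l + 1 ≤ L) :
    (W (l + 1))ᵀ * grad W Φ L (l + 1) = grad W Φ L l * (W l)ᵀ := by
  obtain ⟨k, rfl⟩ := Nat.exists_eq_add_of_le' hl
  simp only [grad, Nat.add_sub_cancel]
  rw [seg_eq_seg_succ_mul W (by omega) hlL, seg_succ W (n := k) (by omega)]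
  simp only [Matrix.transpose_mul, Matrix.mul_assoc]

theorem hasDerivWithinAt_mul_apply {m n p : Type*} [Fintype n] {A : ℝ → Matrix m n ℝ}
    {B : ℝ → Matrix n p ℝ} {A' : Matrix m n ℝ} {B' : Matrix n p ℝ} {s : Set ℝ} {t : ℝ}
    (hA : ∀ i j, HasDerivWithinAt (fun x => A x i j) (A' i j) s t)
    (hB : ∀ i j, HasDerivWithinAt (fun x => B x i j) (B' i j) s t) (i : m) (j : p) :
    HasDerivWithinAt (fun x => (A x * B x) i j) ((A' * B t + A t * B') i j) s t := by
  simp only [Matrix.add_apply, Matrix.mul_apply, ← Finset.sum_add_distrib]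
  exact HasDerivWithinAt.fun_sum fun k _ => (hA i k).fun_mul (hB k j)

theorem hasDerivWithinAt_Dmat_apply {d L : ℕ} {Φ : Matrix (Fin d) (Fin d) ℝ}
    {W : ℕ → ℝ → Matrix (Fin d) (Fin d) ℝ} {s : Set ℝ} {t : ℝ}
    (hW : ∀ l, 1 ≤ l → l ≤ L → ∀ i j,
      HasDerivWithinAt (fun x => W l x i j) (-(grad (fun k => W k t) Φ L l i j)) s t)
    {l : ℕ} (hl : 1 ≤ l) (hlL : l + 1 ≤ L) (i j : Fin d) :
    HasDerivWithinAt (fun x => Dmat (fun k => W k x) l i j) 0 s t := by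
  set G := grad (fun k => W k t) Φ L with hG
  have h₁ : ∀ i j, HasDerivWithinAt (fun x => W l x i j) ((-G l) i j) s t :=
    hW l hl (by omega)
  have h₂ : ∀ i j, HasDerivWithinAt (fun x => W (l + 1) x i j) ((-G (l + 1)) i j) s t :=
    hW (l + 1) (by omega) hlL
  have h := (hasDerivWithinAt_mul_apply (A := fun x => (W (l + 1) x)ᵀ)
    (A' := (-G (l + 1))ᵀ) (fun i j => h₂ j i) h₂ i j).fun_sub
    (hasDerivWithinAt_mul_apply (B := fun x => (W l x)ᵀ)
      (B' := (-G l)ᵀ) h₁ (fun i j => h₁ j i) i j)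
  refine h.congr_deriv ?_
  have e : (W (l + 1) t)ᵀ * G (l + 1) = G l * (W l t)ᵀ :=
    transpose_mul_grad_succ (fun k => W k t) Φ hl hlL
  have e' : (G (l + 1))ᵀ * W (l + 1) t = W l t * (G l)ᵀ := by
    simpa only [Matrix.transpose_mul, Matrix.transpose_transpose] using
      congrArg Matrix.transpose e
  rw [← Matrix.sub_apply]
  simp only [Matrix.transpose_neg, Matrix.neg_mul, Matrix.mul_neg, e, e']
  rw [add_comm, sub_self, Matrix.zero_apply]

/-- Lemma 1: the matrices `D_l = W_{l+1}ᵀ W_{l+1} - W_l W_lᵀ` are invariant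
under continuous-time gradient descent (arbitrary initialization). -/
theorem continuous_gd_invariant_matrices
    (d L : ℕ) (hd : 1 ≤ d) (hL : 2 ≤ L)
    (Φ : Matrix (Fin d) (Fin d) ℝ)
    (W : ℕ → ℝ → Matrix (Fin d) (Fin d) ℝ)
    (hdyn : ∀ t ∈ Set.Ici (0:ℝ), ∀ l, 1 ≤ l → l ≤ L → ∀ i j,
      HasDerivWithinAt (fun s => W l s i j)
        (-((grad (fun k => W k t) Φ L l) i j)) (Set.Ici 0) t) :
    ∀ l, 1 ≤ l → l ≤ L - 1 → ∀ t ∈ Set.Ici (0:ℝ),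
      Dmat (fun k => W k t) l = Dmat (fun k => W k 0) l := by
  intro l hl hlL t ht
  ext i j
  have hD : ∀ x ∈ Set.Ici (0 : ℝ),
      HasDerivWithinAt (fun x => Dmat (fun k => W k x) l i j) 0 (Set.Ici 0) x :=
    fun x hx => hasDerivWithinAt_Dmat_apply (hdyn x hx) hl (by omega) i j
  exact constant_of_has_deriv_right_zero
    (fun x hx => (hD x hx.1).continuousWithinAt.mono Set.Icc_subset_Ici_self)
    (fun x hx => (hD x hx.1).mono (Set.Ici_subset_Ici.2 hx.1)) t ⟨ht, le_rfl⟩
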